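/- Let σ: S ↷ G be a non-automorphic algebraic action and let χ ∈ Ê. Then χ lies in the boundary ∂Ê if and only if for every gC ∈ ℰ× with χ(gC) = 1, every D ∈ 𝒞 with D ⊆ C and [C : D] < ∞, and every k₁, …, k_n ∈ G with C = k₁D ⊔ ⋯ ⊔ k_nD a disjoint coset decomposition, there exists i with χ(g·k_iD) = 1. -/

import Mathlib

open scoped Pointwise

/-- The family of `S`-constructible subgroups of `G`. -/
inductive IsConstructible {S G : Type*} [Monoid S] [Group G]
    (σ : S →* Monoid.End G) : Subgroup G → Prop
  | top : IsConstructible σ ⊤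
  | map : ∀ (s : S) (C : Subgroup G), IsConstructible σ C →
      IsConstructible σ (Subgroup.map (σ s) C)
  | comap : ∀ (s : S) (C : Subgroup G), IsConstructible σ C →
      IsConstructible σ (Subgroup.comap (σ s) C)

/-- The semilattice `ℰ` of `S`-constructible cosets together with `∅`. -/
def ECoset {S G : Type*} [Monoid S] [Group G] (σ : S →* Monoid.End G) : Set (Set G) :=
  {E | E = ∅ ∨ ∃ (g : G) (C : Subgroup G), IsConstructible σ C ∧ E = g • (C : Set G)}

/-- A character of `ℰ`: multiplicative, sends `∅` to `0` and `G` to `1`.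
(We represent characters as Boolean functions on `Set G`, pinned to `false`
outside `ℰ`, so that equality of characters is equality of functions and the
topology of pointwise convergence is the product topology.) -/
def IsChar {S G : Type*} [Monoid S] [Group G] (σ : S →* Monoid.End G)
    (χ : Set G → Bool) : Prop :=
  χ ∅ = false ∧ χ Set.univ = true ∧
  (∀ E F : Set G, E ∈ ECoset σ → F ∈ ECoset σ → χ (E ∩ F) = (χ E && χ F)) ∧
  (∀ E : Set G, E ∉ ECoset σ → χ E = false)

/-- The filter of a character: the collection of elements of `ℰ` on which it is `1`. -/
def charFilter {G : Type*} (χ : Set G → Bool) : Set (Set G) := {E | χ E = true}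

/-- A character is maximal if its filter is maximal with respect to inclusion. -/
def IsMaxChar {S G : Type*} [Monoid S] [Group G] (σ : S →* Monoid.End G)
    (χ : Set G → Bool) : Prop :=
  IsChar σ χ ∧ ∀ ω : Set G → Bool, IsChar σ ω → charFilter χ ⊆ charFilter ω →
    charFilter ω = charFilter χ

theorem IsConstructible.inf {S G : Type*} [Monoid S] [Group G] {σ : S →* Monoid.End G}
    (hinj : ∀ s : S, Function.Injective (σ s)) {C D : Subgroup G}
    (hC : IsConstructible σ C) (hD : IsConstructible σ D) : IsConstructible σ (C ⊓ D) := by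
  induction hC generalizing D with
  | top => simpa using hD
  | map s C _ ih =>
    have h : Subgroup.map (σ s) C ⊓ D = Subgroup.map (σ s) (C ⊓ Subgroup.comap (σ s) D) := by
      ext x
      constructor
      · rintro ⟨⟨y, hy, rfl⟩, hx⟩
        exact ⟨y, ⟨hy, hx⟩, rfl⟩
      · rintro ⟨y, ⟨hy, hx⟩, rfl⟩
        exact ⟨⟨y, hy, rfl⟩, hx⟩
    rw [h]
    exact .map s _ (ih (.comap s D hD))
  | comap s C _ ih =>
    have h : Subgroup.comap (σ s) C ⊓ D = Subgroup.comap (σ s) (C ⊓ Subgroup.map (σ s) D) := by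
      ext x
      constructor
      · rintro ⟨hx, hd⟩
        exact ⟨hx, x, hd, rfl⟩
      · rintro ⟨hx, y, hd, hy⟩
        obtain rfl := hinj s hy
        exact ⟨hx, hd⟩
    rw [h]
    exact .comap s _ (ih (.map s D hD))

theorem IsConstructible.finset_inf {S G ι : Type*} [Monoid S] [Group G]
    {σ : S →* Monoid.End G} (hinj : ∀ s : S, Function.Injective (σ s)) (s : Finset ι)
    {K : ι → Subgroup G} (hK : ∀ i, IsConstructible σ (K i)) : IsConstructible σ (s.inf K) := by
  classical
  induction s using Finset.induction_on with
  | empty => exact .top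
  | insert i s _ ih =>
    rw [Finset.inf_insert]
    exact (hK i).inf hinj ih

theorem smul_mem_ECoset {S G : Type*} [Monoid S] [Group G] {σ : S →* Monoid.End G} (g : G)
    {C : Subgroup G} (hC : IsConstructible σ C) : g • (C : Set G) ∈ ECoset σ :=
  Or.inr ⟨g, C, hC, rfl⟩

theorem univ_mem_ECoset {S G : Type*} [Monoid S] [Group G] (σ : S →* Monoid.End G) :
    (Set.univ : Set G) ∈ ECoset σ :=
  Or.inr ⟨1, ⊤, .top, by simp⟩

theorem smul_coe_eq_of_mem {G : Type*} [Group G] {g x : G} {C : Subgroup G}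
    (hx : x ∈ g • (C : Set G)) : g • (C : Set G) = x • (C : Set G) := by
  rw [mem_leftCoset_iff] at hx
  exact (leftCoset_eq_iff C).2 hx

theorem exists_eq_smul_of_mem_ECoset {S G : Type*} [Monoid S] [Group G] {σ : S →* Monoid.End G}
    {E : Set G} {x : G} (hE : E ∈ ECoset σ) (hx : x ∈ E) :
    ∃ C : Subgroup G, IsConstructible σ C ∧ E = x • (C : Set G) := by
  obtain rfl | ⟨g, C, hC, rfl⟩ := hE
  · exact hx.elim
  · exact ⟨C, hC, smul_coe_eq_of_mem hx⟩

theorem inter_mem_ECoset {S G : Type*} [Monoid S] [Group G] {σ : S →* Monoid.End G}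
    (hinj : ∀ s : S, Function.Injective (σ s)) {E F : Set G}
    (hE : E ∈ ECoset σ) (hF : F ∈ ECoset σ) : E ∩ F ∈ ECoset σ := by
  obtain h | ⟨x, hxE, hxF⟩ := (E ∩ F).eq_empty_or_nonempty
  · exact Or.inl h
  · obtain ⟨C, hC, rfl⟩ := exists_eq_smul_of_mem_ECoset hE hxE
    obtain ⟨D, hD, rfl⟩ := exists_eq_smul_of_mem_ECoset hF hxF
    exact Or.inr ⟨x, C ⊓ D, hC.inf hinj hD, by rw [Subgroup.coe_inf, Set.smul_set_inter]⟩

namespace IsChar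

variable {S G : Type*} [Monoid S] [Group G] {σ : S →* Monoid.End G} {χ : Set G → Bool}

theorem mem_ECoset (hχ : IsChar σ χ) {E : Set G} (hE : χ E = true) : E ∈ ECoset σ := by
  by_contra h
  simp [hχ.2.2.2 E h] at hE

theorem nonempty (hχ : IsChar σ χ) {E : Set G} (hE : χ E = true) : E.Nonempty := by
  rw [Set.nonempty_iff_ne_empty]
  rintro rfl
  simp [hχ.1] at hE

theorem inter (hχ : IsChar σ χ) {E F : Set G} (hE : χ E = true) (hF : χ F = true) :
    χ (E ∩ F) = true := by
  rw [hχ.2.2.1 E F (hχ.mem_ECoset hE) (hχ.mem_ECoset hF), hE, hF, Bool.and_self]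

theorem mono (hχ : IsChar σ χ) {E F : Set G} (hE : χ E = true) (hF : F ∈ ECoset σ)
    (h : E ⊆ F) : χ F = true := by
  have := hχ.2.2.1 E F (hχ.mem_ECoset hE) hF
  rw [Set.inter_eq_left.2 h, hE, Bool.true_and] at this
  exact this.symm

theorem biInter (hχ : IsChar σ χ) {ι : Type*} (s : Finset ι) {f : ι → Set G}
    (hf : ∀ i ∈ s, χ (f i) = true) : χ (⋂ i ∈ s, f i) = true := by
  classical
  induction s using Finset.induction_on with
  | empty => simpa using hχ.2.1
  | insert i s _ ih =>
    rw [Finset.set_biInter_insert]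
    exact hχ.inter (hf i (by simp)) (ih fun j hj => hf j (by simp [hj]))

end IsChar

open Classical in
/-- The character whose filter consists of the constructible cosets containing `x`. -/
noncomputable def pointChar {S G : Type*} [Monoid S] [Group G] (σ : S →* Monoid.End G) (x : G) :
    Set G → Bool :=
  fun E => decide (E ∈ ECoset σ ∧ x ∈ E)

theorem pointChar_eq_true {S G : Type*} [Monoid S] [Group G] {σ : S →* Monoid.End G} {x : G}
    {E : Set G} : pointChar σ x E = true ↔ E ∈ ECoset σ ∧ x ∈ E := by
  simp [pointChar]

theorem isChar_pointChar {S G : Type*} [Monoid S] [Group G] {σ : S →* Monoid.End G}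
    (hinj : ∀ s : S, Function.Injective (σ s)) (x : G) : IsChar σ (pointChar σ x) := by
  refine ⟨by simp [pointChar], by simp [pointChar, univ_mem_ECoset], fun E F hE hF => ?_,
    fun E hE => by simp [pointChar, hE]⟩
  rw [Bool.eq_iff_iff, Bool.and_eq_true]
  simp [pointChar_eq_true, hE, hF, inter_mem_ECoset hinj hE hF]

theorem isMaxChar_pointChar {S G : Type*} [Monoid S] [Group G] {σ : S →* Monoid.End G}
    (hinj : ∀ s : S, Function.Injective (σ s)) (x : G) : IsMaxChar σ (pointChar σ x) := by
  refine ⟨isChar_pointChar hinj x, fun ω hω hle => Set.Subset.antisymm (fun E hE => ?_) hle⟩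
  have hEω : ω E = true := hE
  obtain rfl | ⟨g, C, hC, rfl⟩ := hω.mem_ECoset hEω
  · simp [hω.1] at hEω
  have hx : ω (x • (C : Set G)) = true :=
    hle (pointChar_eq_true.2 ⟨smul_mem_ECoset x hC, mem_own_leftCoset C.toSubmonoid x⟩)
  obtain ⟨y, hyg, hyx⟩ := hω.nonempty (hω.inter hEω hx)
  refine pointChar_eq_true.2 ⟨smul_mem_ECoset g hC, ?_⟩
  rw [smul_coe_eq_of_mem hyg, ← smul_coe_eq_of_mem hyx]
  exact mem_own_leftCoset C.toSubmonoid x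

theorem IsMaxChar.exists_disjoint {S G : Type*} [Monoid S] [Group G] {σ : S →* Monoid.End G}
    (hinj : ∀ s : S, Function.Injective (σ s)) {ω : Set G → Bool} (hω : IsMaxChar σ ω)
    {F : Set G} (hF : F ∈ ECoset σ) (hωF : ω F = false) :
    ∃ E, ω E = true ∧ E ∩ F = ∅ := by
  classical
  by_contra! hne
  obtain ⟨hchar, hmax⟩ := hω
  let ω' : Set G → Bool := fun A => decide (A ∈ ECoset σ ∧ ∃ E, ω E = true ∧ E ∩ F ⊆ A)
  have hω' : IsChar σ ω' := by
    refine ⟨?_, ?_, fun A B hA hB => ?_, fun A hA => by simp [ω', hA]⟩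
    · refine decide_eq_false ?_
      rintro ⟨-, E, hE, hsub⟩
      exact (hne E hE).ne_empty (Set.subset_empty_iff.1 hsub)
    · exact decide_eq_true ⟨univ_mem_ECoset σ, Set.univ, hchar.2.1, Set.subset_univ _⟩
    · rw [Bool.eq_iff_iff, Bool.and_eq_true]
      simp only [ω', decide_eq_true_eq, hA, hB, inter_mem_ECoset hinj hA hB, true_and]
      constructor
      · rintro ⟨E, hE, hsub⟩
        exact ⟨⟨E, hE, hsub.trans Set.inter_subset_left⟩,
          ⟨E, hE, hsub.trans Set.inter_subset_right⟩⟩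
      · rintro ⟨⟨E, hE, hEA⟩, ⟨E', hE', hEB⟩⟩
        exact ⟨E ∩ E', hchar.inter hE hE',
          fun y hy => ⟨hEA ⟨hy.1.1, hy.2⟩, hEB ⟨hy.1.2, hy.2⟩⟩⟩
  have hle : charFilter ω ⊆ charFilter ω' := fun E hE =>
    decide_eq_true ⟨hchar.mem_ECoset hE, E, hE, Set.inter_subset_left⟩
  have hFω' : F ∈ charFilter ω' :=
    decide_eq_true ⟨hF, Set.univ, hchar.2.1, Set.inter_subset_right⟩
  rw [hmax ω' hω' hle] at hFω'
  exact absurd hFω' (by simp [charFilter, hωF])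

theorem exists_leftCoset_decomposition {G : Type*} [Group G] {C D : Subgroup G} (hDC : D ≤ C)
    (h : D.relIndex C ≠ 0) :
    ∃ (n : ℕ) (k : Fin n → G), (∀ i, k i ∈ C) ∧ (C : Set G) = ⋃ i, k i • (D : Set G) ∧
      ∀ i j, i ≠ j → (k i • (D : Set G)) ∩ (k j • (D : Set G)) = ∅ := by
  have : (D.subgroupOf C).FiniteIndex := ⟨h⟩
  obtain ⟨n, ⟨e⟩⟩ := Finite.exists_equiv_fin (C ⧸ D.subgroupOf C)
  have hmem : ∀ (i : Fin n) (x : C),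
      (x : G) ∈ ((e.symm i).out : G) • (D : Set G) ↔ e (x : C ⧸ D.subgroupOf C) = i := by
    intro i x
    rw [mem_leftCoset_iff, ← Equiv.eq_symm_apply, eq_comm]
    conv_rhs => rw [← QuotientGroup.out_eq' (e.symm i)]
    rw [QuotientGroup.eq]
    rfl
  have hsub : ∀ i, ((e.symm i).out : G) • (D : Set G) ⊆ C := by
    rintro i _ ⟨d, hd, rfl⟩
    exact C.mul_mem (e.symm i).out.2 (hDC hd)
  refine ⟨n, fun i => ((e.symm i).out : G), fun i => (e.symm i).out.2, ?_, fun i j hij => ?_⟩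
  · refine Set.Subset.antisymm (fun x hx => ?_) (Set.iUnion_subset hsub)
    exact Set.mem_iUnion.2 ⟨_, (hmem _ ⟨x, hx⟩).2 rfl⟩
  · refine Set.eq_empty_of_forall_notMem fun x hx => hij ?_
    have hxC : x ∈ C := hsub i hx.1
    rw [← (hmem i ⟨x, hxC⟩).1 hx.1, ← (hmem j ⟨x, hxC⟩).1 hx.2]

theorem relIndex_finset_inf_ne_zero {G ι : Type*} [Group G] (C : Subgroup G) (s : Finset ι)
    {K : ι → Subgroup G} (hK : ∀ i ∈ s, (K i).relIndex C ≠ 0) : (s.inf K).relIndex C ≠ 0 := by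
  classical
  induction s using Finset.induction_on with
  | empty => simp
  | insert i s _ ih =>
    rw [Finset.inf_insert]
    exact Subgroup.relIndex_inf_ne_zero (hK i (by simp)) (ih fun j hj => hK j (by simp [hj]))

/-- Under the finite-index splitting condition, no coset in the filter of `χ` is covered by
finitely many constructible cosets outside it. -/
theorem IsChar.exists_mem_forall_notMem {S G : Type*} [Monoid S] [Group G]
    {σ : S →* Monoid.End G} (hinj : ∀ s : S, Function.Injective (σ s))
    {χ : Set G → Bool} (hχ : IsChar σ χ) {g : G} {C : Subgroup G} (hC : IsConstructible σ C)
    (h : ∀ D : Subgroup G, IsConstructible σ D → D ≤ C → D.relIndex C ≠ 0 →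
      ∀ (n : ℕ) (k : Fin n → G),
        (C : Set G) = ⋃ i, k i • (D : Set G) →
        (∀ i j, i ≠ j → (k i • (D : Set G)) ∩ (k j • (D : Set G)) = ∅) →
        ∃ i, χ ((g * k i) • (D : Set G)) = true)
    (T : Finset (Set G)) (hT : ∀ F ∈ T, F ∈ ECoset σ ∧ χ F = false) :
    ∃ x ∈ g • (C : Set G), ∀ F ∈ T, x ∉ F := by
  classical
  by_contra! hcov
  let ι := {F : T // ∃ c : C, g * c ∈ (F : Set G)}
  have hι : ∀ i : ι, ∃ (c : C) (K : Subgroup G),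
      IsConstructible σ K ∧ (i.1 : Set G) = (g * c) • (K : Set G) := by
    rintro ⟨F, c, hc⟩
    exact ⟨c, exists_eq_smul_of_mem_ECoset (hT F F.2).1 hc⟩
  choose c K hK hF using hι
  have hcovC : ⋃ i ∈ (Finset.univ : Finset ι),
      c i • ((K i).subgroupOf C : Set C) = Set.univ := by
    refine Set.eq_univ_of_forall fun y => ?_
    obtain ⟨F, hFT, hyF⟩ := hcov (g * y) ⟨y, y.2, rfl⟩
    refine Set.mem_iUnion₂.2 ⟨⟨⟨F, hFT⟩, y, hyF⟩, Finset.mem_univ _, ?_⟩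
    have hy := hF ⟨⟨F, hFT⟩, y, hyF⟩
    rw [show F = _ from hy, mem_leftCoset_iff] at hyF
    rw [mem_leftCoset_iff]
    simpa [Subgroup.mem_subgroupOf, mul_assoc] using hyF
  have hfin := Subgroup.leftCoset_cover_filter_FiniteIndex hcovC
  let s : Finset ι := Finset.univ.filter fun i => ((K i).subgroupOf C).FiniteIndex
  let D : Subgroup G := C ⊓ s.inf K
  have hD : IsConstructible σ D := hC.inf hinj (.finset_inf hinj s hK)
  have hDindex : D.relIndex C ≠ 0 := by
    refine Subgroup.relIndex_inf_ne_zero (by simp) (relIndex_finset_inf_ne_zero C s ?_)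
    intro i hi
    exact (Finset.mem_filter.1 hi).2.index_ne_zero
  obtain ⟨n, k, hkC, hk, hdisj⟩ := exists_leftCoset_decomposition inf_le_left hDindex
  obtain ⟨m, hm⟩ := h D hD inf_le_left hDindex n k hk hdisj
  have hkm : (⟨k m, hkC m⟩ : C) ∈ (Set.univ : Set C) := Set.mem_univ _
  rw [← hfin] at hkm
  obtain ⟨i, hi, hki⟩ := Set.mem_iUnion₂.1 hkm
  have hDK : D ≤ K i := inf_le_right.trans (Finset.inf_le hi)
  have hki' : g * k m ∈ (g * c i) • (K i : Set G) := by
    rw [mem_leftCoset_iff] at hki ⊢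
    simpa [Subgroup.mem_subgroupOf, mul_assoc] using hki
  have htrue : χ i.1 = true := by
    refine hχ.mono hm (hT _ i.1.2).1 ?_
    rw [hF i, smul_coe_eq_of_mem hki']
    exact Set.smul_set_mono hDK
  simp [(hT _ i.1.2).2] at htrue

/-- Lemma 3.4 (lem:CharTightChar): a character `χ ∈ Ê` is tight (lies in the
boundary `∂Ê`, the closure of the maximal characters) if and only if for every
constructible coset `gC` with `χ(gC) = 1` and every finite-index constructible
`D ⊆ C` with a disjoint coset decomposition `C = ⊔ᵢ kᵢD`, there is `i` with
`χ(gkᵢD) = 1`. -/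
theorem tight_character_characterization {S G : Type*} [Monoid S] [Group G] [Nontrivial G]
    (σ : S →* Monoid.End G)
    (hinj : ∀ s : S, Function.Injective (σ s))
    (hfaith : Function.Injective σ)
    (hna : ∃ s : S, Set.range (σ s : G → G) ≠ Set.univ)
    (χ : Set G → Bool) (hχ : IsChar σ χ) :
    χ ∈ closure {ω : Set G → Bool | IsMaxChar σ ω} ↔
      ∀ (g : G) (C : Subgroup G), IsConstructible σ C → χ (g • (C : Set G)) = true →
      ∀ D : Subgroup G, IsConstructible σ D → D ≤ C → D.relIndex C ≠ 0 →
      ∀ (n : ℕ) (k : Fin n → G),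
        (C : Set G) = ⋃ i, k i • (D : Set G) →
        (∀ i j, i ≠ j → (k i • (D : Set G)) ∩ (k j • (D : Set G)) = ∅) →
        ∃ i, χ ((g * k i) • (D : Set G)) = true := by
  classical
  constructor
  · intro hcl g C hC hgC D hD _ _ n k hk _
    by_contra! hno
    simp only [Bool.not_eq_true, ne_eq] at hno
    let U : Set (Set G → Bool) := {ω | ω (g • (C : Set G)) = true} ∩
      ⋂ i, {ω | ω ((g * k i) • (D : Set G)) = false}
    have hcoord : ∀ (A : Set G) (b : Bool), IsOpen {ω : Set G → Bool | ω A = b} := fun A b =>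
      (isOpen_discrete ({b} : Set Bool)).preimage
        (continuous_apply A : Continuous fun ω : Set G → Bool => ω A)
    have hU : IsOpen U := (hcoord _ _).inter (isOpen_iInter_of_finite fun i => hcoord _ _)
    obtain ⟨ω, ⟨hωC, hωD⟩, hω⟩ := mem_closure_iff.1 hcl U hU ⟨hgC, Set.mem_iInter.2 hno⟩
    have hωmax : IsMaxChar σ ω := hω
    choose E hE hEk using fun i => hωmax.exists_disjoint hinj
      (smul_mem_ECoset (g * k i) hD) (Set.mem_iInter.1 hωD i)
    obtain ⟨x, hxC, hxE⟩ := hωmax.1.nonempty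
      (hωmax.1.inter hωC (hωmax.1.biInter Finset.univ fun i _ => hE i))
    rw [hk, Set.smul_set_iUnion] at hxC
    obtain ⟨i, hi⟩ := Set.mem_iUnion.1 hxC
    rw [smul_smul] at hi
    have hx : x ∈ E i ∩ (g * k i) • (D : Set G) :=
      ⟨Set.mem_iInter₂.1 hxE i (Finset.mem_univ i), hi⟩
    rw [hEk i] at hx
    exact hx
  · intro h
    rw [mem_closure_iff]
    intro U hU hχU
    obtain ⟨I, u, hu, hIU⟩ := isOpen_pi_iff.1 hU χ hχU
    have hE := hχ.biInter (I.filter fun F => χ F = true) (f := id)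
      fun F hF => (Finset.mem_filter.1 hF).2
    obtain ⟨y, hy⟩ := hχ.nonempty hE
    obtain ⟨C, hC, hEC⟩ := exists_eq_smul_of_mem_ECoset (hχ.mem_ECoset hE) hy
    rw [hEC] at hE
    obtain ⟨x, hxE, hxF⟩ := hχ.exists_mem_forall_notMem hinj hC (h y C hC hE)
      (I.filter fun F => F ∈ ECoset σ ∧ χ F = false) fun F hF => (Finset.mem_filter.1 hF).2
    refine ⟨pointChar σ x, hIU fun F hF => ?_, isMaxChar_pointChar hinj x⟩
    have hFI : F ∈ I := hF
    suffices heq : pointChar σ x F = χ F by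
      rw [heq]
      exact (hu F hFI).2
    rw [Bool.eq_iff_iff, pointChar_eq_true]
    constructor
    · rintro ⟨hFE, hx⟩
      by_contra hF0
      exact hxF F (Finset.mem_filter.2 ⟨hFI, hFE, by simpa using hF0⟩) hx
    · intro hF1
      rw [← hEC] at hxE
      exact ⟨hχ.mem_ECoset hF1,
        Set.mem_iInter₂.1 hxE F (Finset.mem_filter.2 ⟨hFI, hF1⟩)⟩
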